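/- Theta inversion formula: let M be a symmetric positive definite integral m×m matrix with det M = 1. Then for all Ω ∈ ℍ_n and Z ∈ ℂ^{m×n}, Θ_M(−Ω^{-1}, ZΩ^{-1}) = (−i)^{mn/2}·det(Ω)^{m/2}·exp(πi·tr(M·Z·Ω^{-1}·ᵗZ))·Θ_M(Ω,Z), where Θ_M(Ω,Z) = Σ_{ξ∈ℤ^{m×n}} exp(πi·tr(M(ξΩᵗξ+2ξᵗZ))) and det(Ω)^{m/2} is taken via the holomorphic branch of det^{1/2}(Ω/i) times i^{n/2} consistent with the positive value at Ω = iI_n. -/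

import Mathlib

open Matrix

noncomputable section

/-- Cast a real matrix to a complex matrix entrywise. -/
def mc {k l : ℕ} (A : Matrix (Fin k) (Fin l) ℝ) : Matrix (Fin k) (Fin l) ℂ :=
  A.map Complex.ofReal

/-- The Siegel upper half plane: symmetric with positive definite imaginary part. -/
def InSiegel {n : ℕ} (Ω : Matrix (Fin n) (Fin n) ℂ) : Prop :=
  Ω.IsSymm ∧ (Ω.map Complex.im).PosDef

/-- The theta kernel `F_{Ω,Z}(x) = exp(πi·tr(M(xΩᵗx + 2xᵗZ)))`. -/
def thetaKernel {n m : ℕ} (M : Matrix (Fin m) (Fin m) ℝ)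
    (Ω : Matrix (Fin n) (Fin n) ℂ) (Z : Matrix (Fin m) (Fin n) ℂ)
    (x : Matrix (Fin m) (Fin n) ℂ) : ℂ :=
  Complex.exp ((Real.pi : ℂ) * Complex.I *
    (mc M * (x * Ω * xᵀ + (2 : ℂ) • (x * Zᵀ))).trace)

/-- Cast an integer array to a complex matrix. -/
def zc {k l : ℕ} (ξ : Fin k → Fin l → ℤ) : Matrix (Fin k) (Fin l) ℂ :=
  Matrix.of fun i j => ((ξ i j : ℤ) : ℂ)

/-- The theta series `Θ_M(Ω,Z) = Σ_{ξ∈ℤ^{m×n}} exp(πi·tr(M(ξΩᵗξ+2ξᵗZ)))`. -/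
def Theta {n m : ℕ} (M : Matrix (Fin m) (Fin m) ℝ)
    (Ω : Matrix (Fin n) (Fin n) ℂ) (Z : Matrix (Fin m) (Fin n) ℂ) : ℂ :=
  ∑' ξ : Fin m → Fin n → ℤ, thetaKernel M Ω Z (zc ξ)

/-- Symmetric complex matrices with positive definite real part. -/
def InS {n : ℕ} (S : Matrix (Fin n) (Fin n) ℂ) : Prop :=
  S.IsSymm ∧ (S.map Complex.re).PosDef

theorem InS.re_star_dotProduct_pos {n : ℕ} {A : Matrix (Fin n) (Fin n) ℂ} (hA : InS A)
    {v : Fin n → ℂ} (hv : v ≠ 0) : 0 < (star v ⬝ᵥ A *ᵥ v).re := by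
  have hsplit : (star v ⬝ᵥ A *ᵥ v).re =
      (fun i => (v i).re) ⬝ᵥ A.map Complex.re *ᵥ (fun i => (v i).re) +
      (fun i => (v i).im) ⬝ᵥ A.map Complex.re *ᵥ (fun i => (v i).im) := by
    have hcross : ∑ i, ∑ j, ((v i).re * (A i j).im * (v j).im) =
        ∑ i, ∑ j, ((v i).im * (A i j).im * (v j).re) := by
      rw [Finset.sum_comm]
      refine Finset.sum_congr rfl fun i _ => Finset.sum_congr rfl fun j _ => ?_
      rw [hA.1.apply i j]; ring
    rw [← sub_eq_zero] at hcross
    rw [← sub_zero (_ + _), ← hcross]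
    simp only [dotProduct, mulVec, Complex.re_sum, Finset.mul_sum, ← Finset.sum_add_distrib,
      ← Finset.sum_sub_distrib]
    refine Finset.sum_congr rfl fun i _ => Finset.sum_congr rfl fun j _ => ?_
    simp
    ring
  have hnonneg := fun x : Fin n → ℝ => hA.2.posSemidef.dotProduct_mulVec_nonneg x
  have hpos := fun x : Fin n → ℝ => fun hx : x ≠ 0 => hA.2.dotProduct_mulVec_pos hx
  simp only [star_trivial] at hnonneg hpos
  rw [hsplit]
  by_cases h : (fun i => (v i).re) = 0
  · refine add_pos_of_nonneg_of_pos (hnonneg _) (hpos _ fun h' => hv ?_)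
    ext i
    exact Complex.ext (congrFun h i) (congrFun h' i)
  · exact add_pos_of_pos_of_nonneg (hpos _ h) (hnonneg _)

theorem inS_of_re_dotProduct_pos {n : ℕ} {A : Matrix (Fin n) (Fin n) ℂ} (hA : A.IsSymm)
    (h : ∀ x : Fin n → ℝ, x ≠ 0 →
      0 < ((fun i => (x i : ℂ)) ⬝ᵥ A *ᵥ (fun i => (x i : ℂ))).re) : InS A := by
  refine ⟨hA, PosDef.of_dotProduct_mulVec_pos ?_ fun x hx => ?_⟩
  · ext i j
    simp [hA.apply i j]
  · refine (h x hx).trans_eq ?_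
    simp [dotProduct, mulVec, Finset.mul_sum]

/-- The first row of a matrix without its first entry. -/
def pivotRow {N : ℕ} (A : Matrix (Fin (N + 1)) (Fin (N + 1)) ℂ) : Fin N → ℂ :=
  fun j => A 0 j.succ

/-- The Schur complement of the top left entry. -/
def schurCompl {N : ℕ} (A : Matrix (Fin (N + 1)) (Fin (N + 1)) ℂ) :
    Matrix (Fin N) (Fin N) ℂ :=
  Matrix.of fun i j => A i.succ j.succ - A i.succ 0 * A 0 j.succ / A 0 0

theorem dotProduct_mulVec_vecCons {N : ℕ} {A : Matrix (Fin (N + 1)) (Fin (N + 1)) ℂ}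
    (hA : A.IsSymm) (x x' : ℂ) (y y' : Fin N → ℂ) :
    vecCons x y ⬝ᵥ A *ᵥ vecCons x' y' = A 0 0 * x * x' + x * (pivotRow A ⬝ᵥ y') +
      x' * (pivotRow A ⬝ᵥ y) + y ⬝ᵥ A.submatrix Fin.succ Fin.succ *ᵥ y' := by
  simp only [dotProduct, mulVec, Fin.sum_univ_succ, cons_val_zero, cons_val_succ, pivotRow,
    submatrix_apply, mul_add, Finset.mul_sum, Finset.sum_add_distrib]
  have h : ∀ i : Fin N, y i * (A i.succ 0 * x') = x' * (A 0 i.succ * y i) := fun i => by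
    rw [hA.apply]; ring
  simp only [h]
  ring

theorem dotProduct_schurCompl_mulVec {N : ℕ} {A : Matrix (Fin (N + 1)) (Fin (N + 1)) ℂ}
    (hA : A.IsSymm) (y y' : Fin N → ℂ) :
    y ⬝ᵥ schurCompl A *ᵥ y' = y ⬝ᵥ A.submatrix Fin.succ Fin.succ *ᵥ y' -
      (pivotRow A ⬝ᵥ y) * (pivotRow A ⬝ᵥ y') / A 0 0 := by
  simp only [dotProduct, mulVec, pivotRow, schurCompl, submatrix_apply, of_apply]
  rw [Finset.sum_mul_sum, Finset.sum_div, ← Finset.sum_sub_distrib]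
  refine Finset.sum_congr rfl fun i _ => ?_
  rw [Finset.mul_sum, Finset.mul_sum, Finset.sum_div, ← Finset.sum_sub_distrib]
  refine Finset.sum_congr rfl fun j _ => ?_
  rw [hA.apply 0 i.succ]
  ring

/-- The matrix of the quadratic form obtained from `A` by a partial Fourier transform in the
first variable. -/
def partialDual {N : ℕ} (A : Matrix (Fin (N + 1)) (Fin (N + 1)) ℂ) :
    Matrix (Fin (N + 1)) (Fin (N + 1)) ℂ :=
  Matrix.of (vecCons (vecCons (A 0 0)⁻¹ ((-Complex.I / A 0 0) • pivotRow A))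
    fun i => vecCons (-Complex.I / A 0 0 * pivotRow A i) (schurCompl A i))

theorem schurCompl_isSymm {N : ℕ} {A : Matrix (Fin (N + 1)) (Fin (N + 1)) ℂ}
    (hA : A.IsSymm) : (schurCompl A).IsSymm := by
  ext i j
  simp only [transpose_apply, schurCompl, of_apply]
  rw [hA.apply i.succ j.succ, hA.apply 0 j.succ, hA.apply i.succ 0, mul_comm (A 0 j.succ)]

theorem partialDual_isSymm {N : ℕ} {A : Matrix (Fin (N + 1)) (Fin (N + 1)) ℂ}
    (hA : A.IsSymm) : (partialDual A).IsSymm := by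
  ext i j
  refine Fin.cases ?_ (fun i => ?_) i <;> refine Fin.cases ?_ (fun j => ?_) j
  · rfl
  · simp [partialDual]
  · simp [partialDual]
  · simpa [partialDual] using (schurCompl_isSymm hA).apply i j

theorem dotProduct_partialDual_mulVec {N : ℕ} {A : Matrix (Fin (N + 1)) (Fin (N + 1)) ℂ}
    (hA : A.IsSymm) (x : ℂ) (y : Fin N → ℂ) :
    vecCons x y ⬝ᵥ partialDual A *ᵥ vecCons x y = x ^ 2 / A 0 0 -
      2 * Complex.I * x * (pivotRow A ⬝ᵥ y) / A 0 0 + y ⬝ᵥ schurCompl A *ᵥ y := by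
  rw [dotProduct_mulVec_vecCons (partialDual_isSymm hA)]
  have h₁ : pivotRow (partialDual A) = (-Complex.I / A 0 0) • pivotRow A := by
    ext j; simp [pivotRow, partialDual]
  have h₂ : (partialDual A).submatrix Fin.succ Fin.succ = schurCompl A := by
    ext i j; simp [partialDual]
  have h₃ : partialDual A 0 0 = (A 0 0)⁻¹ := by simp [partialDual]
  rw [h₁, h₂, h₃, smul_dotProduct, smul_eq_mul]
  ring

theorem InS.re_pivot_pos {N : ℕ} {A : Matrix (Fin (N + 1)) (Fin (N + 1)) ℂ} (hA : InS A) :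
    0 < (A 0 0).re := by
  simpa using hA.2.diag_pos (i := 0)

theorem InS.pivot_ne_zero {N : ℕ} {A : Matrix (Fin (N + 1)) (Fin (N + 1)) ℂ} (hA : InS A) :
    A 0 0 ≠ 0 := fun h => by simpa [h] using hA.re_pivot_pos

theorem InS.partialDual {N : ℕ} {A : Matrix (Fin (N + 1)) (Fin (N + 1)) ℂ} (hA : InS A) :
    InS (partialDual A) := by
  refine inS_of_re_dotProduct_pos (partialDual_isSymm hA.1) fun u hu => ?_
  have ha := hA.pivot_ne_zero
  set η : ℝ := u 0
  set y : Fin N → ℂ := fun i => (u i.succ : ℂ)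
  have hcons : (fun i => (u i : ℂ)) = vecCons (η : ℂ) y := by
    ext i; refine Fin.cases ?_ (fun i => ?_) i <;> rfl
  set x : ℂ := -(Complex.I * η + pivotRow A ⬝ᵥ y) / A 0 0 with hx
  have hv : vecCons x y ≠ 0 := by
    intro h
    have hy : y = 0 := by
      ext i
      exact congrFun h i.succ
    have hx0 : x = 0 := congrFun h 0
    rw [hx, hy] at hx0
    simp only [dotProduct_zero, add_zero, div_eq_zero_iff, ha, or_false, neg_eq_zero,
      mul_eq_zero, Complex.I_ne_zero, false_or, Complex.ofReal_eq_zero] at hx0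
    refine hu (funext fun i => Fin.cases hx0 (fun i => ?_) i)
    exact Complex.ofReal_eq_zero.mp (congrFun hy i)
  have hpos := hA.re_star_dotProduct_pos hv
  have hstar : star (vecCons x y) = vecCons (star x) y := by
    ext i; refine Fin.cases ?_ (fun i => ?_) i <;> simp [y]
  rw [hstar, dotProduct_mulVec_vecCons hA.1] at hpos
  rw [hcons, dotProduct_partialDual_mulVec hA.1, dotProduct_schurCompl_mulVec hA.1]
  have hax : A 0 0 * x = -(Complex.I * η + pivotRow A ⬝ᵥ y) := by rw [hx]; field_simp
  have e₁ : A 0 0 * star x * x + star x * (pivotRow A ⬝ᵥ y) = star (x * (Complex.I * η)) := by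
    rw [mul_right_comm, hax]
    simp
    ring
  rw [e₁] at hpos
  have e₂ : (star (x * (Complex.I * η))).re = (x * (Complex.I * η)).re := Complex.conj_re _
  rw [Complex.add_re, Complex.add_re, e₂, ← Complex.add_re, ← Complex.add_re] at hpos
  convert hpos using 2
  rw [hx]
  field_simp
  linear_combination ((η : ℂ) ^ 2) * Complex.I_sq

theorem InS.schurCompl {N : ℕ} {A : Matrix (Fin (N + 1)) (Fin (N + 1)) ℂ} (hA : InS A) :
    InS (schurCompl A) := by
  have h : (_root_.schurCompl A).map Complex.re =
      ((_root_.partialDual A).map Complex.re).submatrix Fin.succ Fin.succ := by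
    ext i j; simp [_root_.partialDual]
  exact ⟨schurCompl_isSymm hA.1, h ▸ hA.partialDual.2.submatrix (Fin.succ_injective N)⟩

theorem det_eq_pivot_mul_det_schurCompl {N : ℕ} {A : Matrix (Fin (N + 1)) (Fin (N + 1)) ℂ}
    (ha : A 0 0 ≠ 0) : A.det = A 0 0 * (schurCompl A).det := by
  let B : Matrix (Fin (N + 1)) (Fin (N + 1)) ℂ :=
    Matrix.of (vecCons (A 0) fun i => vecCons 0 (schurCompl A i))
  have hB : A.det = B.det := by
    refine det_eq_of_forall_row_eq_smul_add_const (vecCons 0 fun i => A i.succ 0 / A 0 0) 0 rfl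
      fun i j => ?_
    refine Fin.cases ?_ (fun i => ?_) i
    · simp [B]
    · refine Fin.cases ?_ (fun j => ?_) j
      · simp [B, ha]
      · simp [B, schurCompl]
        ring
  rw [hB, det_succ_column_zero, Fin.sum_univ_succ]
  have : B.submatrix Fin.succ Fin.succ = schurCompl A := by
    ext i j; simp [B]
  simp only [Fin.succAbove_zero, this]
  simp [B]

/-- The branch of `det^(1/2)` on `InS` given by the product of the principal square roots of
the pivots. -/
def sqrtDet : {N : ℕ} → Matrix (Fin N) (Fin N) ℂ → ℂ
  | 0, _ => 1
  | _ + 1, A => A 0 0 ^ (1 / 2 : ℂ) * sqrtDet (schurCompl A)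

theorem sqrtDet_sq {N : ℕ} {A : Matrix (Fin N) (Fin N) ℂ} (hA : InS A) :
    sqrtDet A ^ 2 = A.det := by
  induction N with
  | zero => simp [sqrtDet]
  | succ N ih =>
    rw [sqrtDet, mul_pow, ih hA.schurCompl, det_eq_pivot_mul_det_schurCompl hA.pivot_ne_zero,
      ← Complex.cpow_nat_mul]
    simp

theorem sqrtDet_ne_zero {N : ℕ} {A : Matrix (Fin N) (Fin N) ℂ} (hA : InS A) :
    sqrtDet A ≠ 0 := by
  induction N with
  | zero => simp [sqrtDet]
  | succ N ih =>
    rw [sqrtDet]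
    exact mul_ne_zero (by simp [Complex.cpow_eq_zero_iff, hA.pivot_ne_zero]) (ih hA.schurCompl)

theorem InS.isUnit_det {N : ℕ} {A : Matrix (Fin N) (Fin N) ℂ} (hA : InS A) :
    IsUnit A.det := by
  rw [← sqrtDet_sq hA]
  exact (pow_ne_zero 2 (sqrtDet_ne_zero hA)).isUnit

theorem continuousOn_sqrtDet {N : ℕ} :
    ContinuousOn (sqrtDet : Matrix (Fin N) (Fin N) ℂ → ℂ) {A | InS A} := by
  induction N with
  | zero => exact continuousOn_const
  | succ N ih =>
    have hcont : ∀ i j, ContinuousOn (fun A : Matrix (Fin (N + 1)) (Fin (N + 1)) ℂ => A i j)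
        {A | InS A} := fun i j => (continuous_id.matrix_elem i j).continuousOn
    refine ContinuousOn.mul ((hcont 0 0).cpow_const fun A hA => Or.inl ?_) (ih.comp ?_ ?_)
    · exact InS.re_pivot_pos hA
    · refine continuousOn_pi.mpr fun i => continuousOn_pi.mpr fun j => ?_
      exact (hcont _ _).sub (((hcont _ _).mul (hcont _ _)).div (hcont 0 0)
        fun A hA => InS.pivot_ne_zero hA)
    · exact fun A hA => InS.schurCompl hA

theorem schurCompl_mc {N : ℕ} (S : Matrix (Fin (N + 1)) (Fin (N + 1)) ℝ) :
    ∃ T : Matrix (Fin N) (Fin N) ℝ, schurCompl (mc S) = mc T :=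
  ⟨Matrix.of fun i j => S i.succ j.succ - S i.succ 0 * S 0 j.succ / S 0 0, by
    ext i j; simp [schurCompl, mc]⟩

theorem exists_sqrtDet_mc {N : ℕ} (S : Matrix (Fin N) (Fin N) ℝ) (hS : InS (mc S)) :
    ∃ r : ℝ, 0 < r ∧ sqrtDet (mc S) = r := by
  induction N with
  | zero => exact ⟨1, one_pos, by simp [sqrtDet]⟩
  | succ N ih =>
    obtain ⟨T, hT⟩ := schurCompl_mc S
    obtain ⟨r, hr, hr'⟩ := ih T (hT ▸ hS.schurCompl)
    have hpos : 0 < S 0 0 := by simpa [mc] using hS.re_pivot_pos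
    refine ⟨S 0 0 ^ (1 / 2 : ℝ) * r, by positivity, ?_⟩
    rw [sqrtDet, hT, hr', Complex.ofReal_mul, Complex.ofReal_cpow hpos.le]
    simp [mc]

theorem Matrix.PosDef.exists_pos_mul_sum_sq_le {N : ℕ} {R : Matrix (Fin N) (Fin N) ℝ}
    (hR : R.PosDef) : ∃ δ : ℝ, 0 < δ ∧ ∀ x : Fin N → ℝ, δ * ∑ i, x i ^ 2 ≤ x ⬝ᵥ R *ᵥ x := by
  have hcont : Continuous fun x : EuclideanSpace ℝ (Fin N) => x.ofLp ⬝ᵥ R *ᵥ x.ofLp := by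
    simp only [dotProduct, mulVec]
    fun_prop
  obtain ⟨δ, hδ, hmin⟩ := (isCompact_sphere (0 : EuclideanSpace ℝ (Fin N)) 1).exists_forall_le'
    hcont.continuousOn (a := 0) fun x hx => by
      have hx0 : x.ofLp ≠ 0 := fun h => by
        have : x = 0 := by ext i; exact congrFun h i
        simp [this] at hx
      simpa using hR.dotProduct_mulVec_pos hx0
  refine ⟨δ, hδ, fun x => ?_⟩
  set y : EuclideanSpace ℝ (Fin N) := WithLp.toLp 2 x with hy
  have hsum : ∑ i, x i ^ 2 = ‖y‖ ^ 2 := by simp [EuclideanSpace.real_norm_sq_eq, hy]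
  rw [hsum]
  by_cases h0 : y = 0
  · have : x = 0 := by ext i; simpa [hy] using congrArg (fun z => z.ofLp i) h0
    simp [h0, this]
  · have hn : 0 < ‖y‖ := norm_pos_iff.mpr h0
    have := hmin (‖y‖⁻¹ • y) (by simp [norm_smul, hn.ne'])
    have e : (‖y‖⁻¹ • y).ofLp = ‖y‖⁻¹ • x := rfl
    rw [e, mulVec_smul, dotProduct_smul, smul_dotProduct, smul_eq_mul, smul_eq_mul] at this
    calc δ * ‖y‖ ^ 2 ≤ ‖y‖⁻¹ * (‖y‖⁻¹ * (x ⬝ᵥ R *ᵥ x)) * ‖y‖ ^ 2 := by gcongr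
      _ = _ := by field_simp

theorem summable_prod_apply {α : Type*} {N : ℕ} {g : Fin N → α → ℝ}
    (hg : ∀ i, Summable (g i)) (hpos : ∀ i a, 0 ≤ g i a) :
    Summable fun ξ : Fin N → α => ∏ i, g i (ξ i) := by
  induction N with
  | zero => exact (hasSum_fintype _).summable
  | succ N ih =>
    rw [← (Fin.consEquiv fun _ => α).summable_iff]
    have := (hg 0).mul_of_nonneg (ih (fun i => hg i.succ) fun i => hpos i.succ) (hpos 0)
      fun ξ => Finset.prod_nonneg fun i _ => hpos i.succ _
    refine this.congr fun p => ?_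
    simp [Fin.prod_univ_succ, Fin.consEquiv]

/-- The general term of a Gaussian series. -/
def gaussTerm {N : ℕ} (A : Matrix (Fin N) (Fin N) ℂ) (w x : Fin N → ℂ) : ℂ :=
  Complex.exp (-Real.pi * (x ⬝ᵥ A *ᵥ x) + 2 * Real.pi * Complex.I * (x ⬝ᵥ w))

/-- Cast an integer vector to a complex vector. -/
def intVec {N : ℕ} (ξ : Fin N → ℤ) : Fin N → ℂ := fun i => (ξ i : ℂ)

theorem intVec_vecCons {N : ℕ} (n : ℤ) (ξ : Fin N → ℤ) :
    intVec (vecCons n ξ) = vecCons (n : ℂ) (intVec ξ) := by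
  ext i; refine Fin.cases ?_ (fun i => ?_) i <;> simp [intVec]

theorem summable_gaussTerm {N : ℕ} {A : Matrix (Fin N) (Fin N) ℂ} (hA : InS A)
    (w : Fin N → ℂ) : Summable fun ξ : Fin N → ℤ => gaussTerm A w (intVec ξ) := by
  obtain ⟨δ, hδ, hle⟩ := hA.2.exists_pos_mul_sum_sq_le
  refine Summable.of_norm_bounded
    (g := fun ξ : Fin N → ℤ => ∏ i, ‖jacobiTheta₂_term (ξ i) (w i) (δ * Complex.I)‖) ?_ fun ξ => ?_
  · refine summable_prod_apply (g := fun i n => ‖jacobiTheta₂_term n (w i) (δ * Complex.I)‖)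
      (fun i => ?_) fun i n => norm_nonneg _
    exact ((summable_jacobiTheta₂_term_iff _ _).mpr (by simpa using hδ)).norm
  · simp only [norm_jacobiTheta₂_term]
    rw [← Real.exp_sum, gaussTerm, Complex.norm_exp, Real.exp_le_exp]
    have h := mul_le_mul_of_nonneg_left (hle fun i => (ξ i : ℝ)) Real.pi_pos.le
    have hquad : (intVec ξ ⬝ᵥ A *ᵥ intVec ξ).re =
        (fun i => (ξ i : ℝ)) ⬝ᵥ A.map Complex.re *ᵥ fun i => (ξ i : ℝ) := by
      simp [dotProduct, mulVec, Finset.mul_sum, intVec]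
    have hlin : (intVec ξ ⬝ᵥ w).im = ∑ i, (ξ i : ℝ) * (w i).im := by
      simp [dotProduct, intVec]
    have hre : (-Real.pi * (intVec ξ ⬝ᵥ A *ᵥ intVec ξ) +
        2 * Real.pi * Complex.I * (intVec ξ ⬝ᵥ w)).re =
        -Real.pi * (intVec ξ ⬝ᵥ A *ᵥ intVec ξ).re - 2 * Real.pi * (intVec ξ ⬝ᵥ w).im := by
      simp
      ring
    rw [hre, hquad, hlin, Finset.sum_sub_distrib]
    have e₁ : ∑ i, -Real.pi * (ξ i : ℝ) ^ 2 * ((δ : ℂ) * Complex.I).im =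
        -(Real.pi * (δ * ∑ i, (ξ i : ℝ) ^ 2)) := by
      simp only [Complex.im_ofReal_mul, Complex.I_im, mul_one,
        Finset.mul_sum, ← Finset.sum_neg_distrib]
      exact Finset.sum_congr rfl fun i _ => by ring
    have e₂ : ∑ i, 2 * Real.pi * (ξ i : ℝ) * (w i).im =
        2 * Real.pi * ∑ i, (ξ i : ℝ) * (w i).im := by
      rw [Finset.mul_sum]
      exact Finset.sum_congr rfl fun i _ => by ring
    rw [e₁, e₂]
    linarith

theorem tsum_fin_succ {N : ℕ} {f : (Fin (N + 1) → ℤ) → ℂ} (hf : Summable f) :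
    ∑' ξ, f ξ = ∑' n : ℤ, ∑' ξ : Fin N → ℤ, f (vecCons n ξ) := by
  rw [← (Fin.consEquiv fun _ => ℤ).tsum_eq f]
  exact ((Fin.consEquiv fun _ => ℤ).summable_iff.mpr hf).tsum_prod

theorem tsum_fin_succ_comm {N : ℕ} {f : (Fin (N + 1) → ℤ) → ℂ} (hf : Summable f) :
    ∑' n : ℤ, ∑' ξ : Fin N → ℤ, f (vecCons n ξ) =
      ∑' ξ : Fin N → ℤ, ∑' n : ℤ, f (vecCons n ξ) :=
  (Summable.tsum_comm (f := fun (n : ℤ) (ξ : Fin N → ℤ) => f (vecCons n ξ))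
    ((Fin.consEquiv fun _ => ℤ).summable_iff.mpr hf)).symm

/-- The one-dimensional theta inversion formula. -/
theorem sqrt_mul_tsum_gauss_int {a : ℂ} (ha : 0 < a.re) (z : ℂ) :
    a ^ (1 / 2 : ℂ) * ∑' n : ℤ, Complex.exp (-Real.pi * (a * n ^ 2) +
        2 * Real.pi * Complex.I * (n * z)) =
      ∑' n : ℤ, Complex.exp (-Real.pi * ((n - z) ^ 2 / a)) := by
  have ha0 : a ≠ 0 := fun h => by simp [h] at ha
  have h := jacobiTheta₂_functional_equation z (Complex.I * a)
  have e : -Complex.I * (Complex.I * a) = a := by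
    linear_combination (-a) * Complex.I_sq
  rw [e] at h
  have hl : ∑' n : ℤ, Complex.exp (-Real.pi * (a * n ^ 2) +
      2 * Real.pi * Complex.I * (n * z)) = jacobiTheta₂ z (Complex.I * a) := by
    refine tsum_congr fun n => ?_
    rw [jacobiTheta₂_term]
    congr 1
    linear_combination (-Real.pi * a * (n : ℂ) ^ 2) * Complex.I_sq
  rw [hl, h, ← mul_assoc, ← mul_assoc, mul_one_div_cancel, one_mul, jacobiTheta₂, ← tsum_mul_left]
  · refine tsum_congr fun n => ?_
    rw [jacobiTheta₂_term, ← Complex.exp_add]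
    congr 1
    have := Complex.I_ne_zero
    field_simp
    ring
  · simp [Complex.cpow_eq_zero_iff, ha0]

theorem InS.inv {N : ℕ} {A : Matrix (Fin N) (Fin N) ℂ} (hA : InS A) : InS A⁻¹ := by
  refine inS_of_re_dotProduct_pos hA.1.inv fun x hx => ?_
  set u : Fin N → ℂ := fun i => (x i : ℂ)
  have hu : A *ᵥ A⁻¹ *ᵥ u = u := by
    rw [mulVec_mulVec, mul_nonsing_inv _ hA.isUnit_det, one_mulVec]
  have hv : A⁻¹ *ᵥ u ≠ 0 := fun h => by
    rw [h, mulVec_zero] at hu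
    exact hx (funext fun i => Complex.ofReal_eq_zero.mp (congrFun hu.symm i))
  have hpos := hA.re_star_dotProduct_pos hv
  have hstar : star u = u := by ext i; simp [u]
  have e : star (A⁻¹ *ᵥ u) ⬝ᵥ u = star (u ⬝ᵥ A⁻¹ *ᵥ u) := by
    nth_rewrite 2 [← hstar]
    rw [star_dotProduct_star, dotProduct_comm]
  rw [hu, e] at hpos
  exact hpos.trans_eq (Complex.conj_re _)

theorem gauss_shift_eq_gaussTerm {N : ℕ} {B : Matrix (Fin N) (Fin N) ℂ} (hB : B.IsSymm)
    (w x : Fin N → ℂ) :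
    Complex.exp (-Real.pi * ((x - w) ⬝ᵥ B *ᵥ (x - w))) =
      Complex.exp (-Real.pi * (w ⬝ᵥ B *ᵥ w)) * gaussTerm B (-Complex.I • B *ᵥ w) x := by
  have h : w ⬝ᵥ B *ᵥ x = x ⬝ᵥ B *ᵥ w := by
    rw [dotProduct_mulVec, ← mulVec_transpose, hB, dotProduct_comm]
  rw [gaussTerm, ← Complex.exp_add]
  congr 1
  simp only [mulVec_sub, dotProduct_sub, sub_dotProduct, h, dotProduct_smul, smul_eq_mul]
  linear_combination (2 * Real.pi * (x ⬝ᵥ B *ᵥ w)) * Complex.I_sq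

theorem summable_gauss_shift {N : ℕ} {B : Matrix (Fin N) (Fin N) ℂ} (hB : InS B)
    (w : Fin N → ℂ) : Summable fun ξ : Fin N → ℤ =>
      Complex.exp (-Real.pi * ((intVec ξ - w) ⬝ᵥ B *ᵥ (intVec ξ - w))) := by
  simp only [gauss_shift_eq_gaussTerm hB.1]
  exact (summable_gaussTerm hB _).mul_left _

theorem dotProduct_inv_mulVec_vecCons {N : ℕ} {A : Matrix (Fin (N + 1)) (Fin (N + 1)) ℂ}
    (hA : InS A) (x : ℂ) (y : Fin N → ℂ) :
    vecCons x y ⬝ᵥ A⁻¹ *ᵥ vecCons x y = x ^ 2 / A 0 0 +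
      (y - (x / A 0 0) • pivotRow A) ⬝ᵥ (schurCompl A)⁻¹ *ᵥ
        (y - (x / A 0 0) • pivotRow A) := by
  have ha := hA.pivot_ne_zero
  set u := y - (x / A 0 0) • pivotRow A with hu
  set v := (schurCompl A)⁻¹ *ᵥ u
  set t := (x - pivotRow A ⬝ᵥ v) / A 0 0 with ht
  have hv : schurCompl A *ᵥ v = u := by
    rw [mulVec_mulVec, mul_nonsing_inv _ hA.schurCompl.isUnit_det, one_mulVec]
  have hAv : A *ᵥ vecCons t v = vecCons x y := by
    have hrow : A 0 ⬝ᵥ vecCons t v = x := by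
      rw [dotProduct, Fin.sum_univ_succ]
      change A 0 0 * t + pivotRow A ⬝ᵥ v = x
      rw [ht]; field_simp; ring
    ext i
    refine Fin.cases hrow (fun i => ?_) i
    have hi := congrFun hv i
    simp only [mulVec, dotProduct, schurCompl, of_apply, sub_mul, Finset.sum_sub_distrib, hu,
      Pi.sub_apply, Pi.smul_apply, smul_eq_mul] at hi
    have hs : ∑ j, A i.succ 0 * A 0 j.succ / A 0 0 * v j =
        A i.succ 0 / A 0 0 * (pivotRow A ⬝ᵥ v) := by
      rw [dotProduct, Finset.mul_sum]
      exact Finset.sum_congr rfl fun j _ => by rw [pivotRow]; ring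
    rw [hs] at hi
    simp only [mulVec, dotProduct, Fin.sum_univ_succ, cons_val_zero, cons_val_succ]
    have hp : pivotRow A i = A i.succ 0 := hA.1.apply _ _
    rw [hp] at hi
    have hd : ∑ j, A i.succ j.succ * v j =
      y i - x / A 0 0 * A i.succ 0 + A i.succ 0 / A 0 0 * (pivotRow A ⬝ᵥ v) := by
      linear_combination hi
    rw [hd, ht]
    field_simp
    ring
  have hinv : A⁻¹ *ᵥ vecCons x y = vecCons t v := by
    rw [← hAv, mulVec_mulVec, nonsing_inv_mul _ hA.isUnit_det, one_mulVec]
  rw [hinv, cons_dotProduct_cons, hu, sub_dotProduct, smul_dotProduct, smul_eq_mul, ht]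
  field_simp
  ring

theorem gaussTerm_vecCons {N : ℕ} {A : Matrix (Fin (N + 1)) (Fin (N + 1)) ℂ}
    (hA : A.IsSymm) (w : Fin (N + 1) → ℂ) (x : ℂ) (y : Fin N → ℂ) :
    gaussTerm A w (vecCons x y) =
      gaussTerm (A.submatrix Fin.succ Fin.succ) (vecTail w) y *
        Complex.exp (-Real.pi * (A 0 0 * x ^ 2) + 2 * Real.pi * Complex.I *
          (x * (w 0 + Complex.I * (pivotRow A ⬝ᵥ y)))) := by
  rw [gaussTerm, gaussTerm, ← Complex.exp_add, dotProduct_mulVec_vecCons hA, cons_dotProduct]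
  congr 1
  simp only [vecHead]
  linear_combination (-2 * Real.pi * x * (pivotRow A ⬝ᵥ y)) * Complex.I_sq

theorem gaussTerm_submatrix_mul_exp {N : ℕ} {A : Matrix (Fin (N + 1)) (Fin (N + 1)) ℂ}
    (hA : A.IsSymm) (w : Fin (N + 1) → ℂ) (x : ℂ) (y : Fin N → ℂ) :
    gaussTerm (A.submatrix Fin.succ Fin.succ) (vecTail w) y *
        Complex.exp (-Real.pi * ((x - (w 0 + Complex.I * (pivotRow A ⬝ᵥ y))) ^ 2 / A 0 0)) =
      Complex.exp (-Real.pi * ((x - w 0) ^ 2 / A 0 0)) *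
        gaussTerm (schurCompl A) (vecTail w + ((x - w 0) / A 0 0) • pivotRow A) y := by
  rw [gaussTerm, gaussTerm, ← Complex.exp_add, ← Complex.exp_add,
    dotProduct_schurCompl_mulVec hA, dotProduct_add, dotProduct_smul, smul_eq_mul,
    dotProduct_comm y (pivotRow A)]
  congr 1
  linear_combination (-Real.pi * (pivotRow A ⬝ᵥ y) ^ 2 / A 0 0) * Complex.I_sq

theorem exp_mul_gaussTerm_schurCompl {N : ℕ} {A : Matrix (Fin (N + 1)) (Fin (N + 1)) ℂ}
    (hA : A.IsSymm) (w : Fin (N + 1) → ℂ) (x : ℂ) (y : Fin N → ℂ) :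
    Complex.exp (-Real.pi * ((x - w 0) ^ 2 / A 0 0)) *
        gaussTerm (schurCompl A) (vecTail w + ((x - w 0) / A 0 0) • pivotRow A) y =
      Complex.exp (-Real.pi * (w 0 ^ 2 / A 0 0)) *
        gaussTerm (partialDual A) (vecCons (-Complex.I * w 0 / A 0 0)
          (vecTail w - (w 0 / A 0 0) • pivotRow A)) (vecCons x y) := by
  rw [gaussTerm, gaussTerm, ← Complex.exp_add, ← Complex.exp_add,
    dotProduct_partialDual_mulVec hA, cons_dotProduct_cons, dotProduct_add, dotProduct_sub,
    dotProduct_smul, dotProduct_smul, smul_eq_mul, smul_eq_mul, dotProduct_comm y (pivotRow A)]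
  congr 1
  linear_combination (2 * Real.pi * x * w 0 / A 0 0) * Complex.I_sq

/-- Theta inversion for a complex symmetric matrix with positive definite real part. -/
theorem sqrtDet_mul_tsum_gaussTerm {N : ℕ} {A : Matrix (Fin N) (Fin N) ℂ} (hA : InS A)
    (w : Fin N → ℂ) :
    sqrtDet A * ∑' ξ : Fin N → ℤ, gaussTerm A w (intVec ξ) =
      ∑' η : Fin N → ℤ,
        Complex.exp (-Real.pi * ((intVec η - w) ⬝ᵥ A⁻¹ *ᵥ (intVec η - w))) := by
  induction N with
  | zero => simp [sqrtDet, gaussTerm]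
  | succ N ih =>
    let G : (Fin (N + 1) → ℤ) → ℂ := fun ξ => Complex.exp (-Real.pi * (w 0 ^ 2 / A 0 0)) *
        gaussTerm (partialDual A) (vecCons (-Complex.I * w 0 / A 0 0)
          (vecTail w - (w 0 / A 0 0) • pivotRow A)) (intVec ξ)
    have hG : Summable G := (summable_gaussTerm hA.partialDual _).mul_left _
    have hleft : A 0 0 ^ (1 / 2 : ℂ) * ∑' ξ : Fin (N + 1) → ℤ, gaussTerm A w (intVec ξ) =
        ∑' ξ : Fin N → ℤ, ∑' n : ℤ, G (vecCons n ξ) := by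
      rw [tsum_fin_succ (summable_gaussTerm hA w), tsum_fin_succ_comm (summable_gaussTerm hA w),
        ← tsum_mul_left]
      refine tsum_congr fun ξ => ?_
      simp only [G, intVec_vecCons, gaussTerm_vecCons hA.1, ← exp_mul_gaussTerm_schurCompl hA.1,
        ← gaussTerm_submatrix_mul_exp hA.1]
      rw [tsum_mul_left, tsum_mul_left, ← sqrt_mul_tsum_gauss_int hA.re_pivot_pos]
      ring
    rw [sqrtDet, mul_right_comm, hleft, ← tsum_fin_succ_comm hG,
      tsum_fin_succ (summable_gauss_shift hA.inv w), ← tsum_mul_right]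
    refine tsum_congr fun n => ?_
    simp only [G, intVec_vecCons, ← exp_mul_gaussTerm_schurCompl hA.1]
    rw [tsum_mul_left, mul_assoc, mul_comm _ (sqrtDet _), ih hA.schurCompl, ← tsum_mul_left]
    refine tsum_congr fun η => ?_
    have hsub : vecCons (n : ℂ) (intVec η) - w = vecCons (n - w 0) (intVec η - vecTail w) := by
      ext i; refine Fin.cases ?_ (fun i => ?_) i <;> simp [vecTail]
    rw [hsub, dotProduct_inv_mulVec_vecCons hA, ← Complex.exp_add, ← sub_sub]
    congr 1
    ring

open scoped Kronecker

/-- The Kronecker product of `M` and `S`, as a matrix indexed by `Fin (m * n)`. -/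
def kron {m n : ℕ} (M : Matrix (Fin m) (Fin m) ℝ) (S : Matrix (Fin n) (Fin n) ℂ) :
    Matrix (Fin (m * n)) (Fin (m * n)) ℂ :=
  (mc M ⊗ₖ S).submatrix finProdFinEquiv.symm finProdFinEquiv.symm

/-- The entries of a matrix listed as a vector. -/
def flatten {m n : ℕ} (X : Matrix (Fin m) (Fin n) ℂ) : Fin (m * n) → ℂ :=
  fun k => X (finProdFinEquiv.symm k).1 (finProdFinEquiv.symm k).2

theorem flatten_sub {m n : ℕ} (X Y : Matrix (Fin m) (Fin n) ℂ) :
    flatten (X - Y) = flatten X - flatten Y := rfl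

theorem flatten_dotProduct_flatten {m n : ℕ} (X Y : Matrix (Fin m) (Fin n) ℂ) :
    flatten X ⬝ᵥ flatten Y = (X * Yᵀ).trace := by
  rw [dotProduct, ← finProdFinEquiv.sum_comp, Fintype.sum_prod_type]
  simp [flatten, trace, mul_apply]

theorem kron_mulVec_flatten {m n : ℕ} (M : Matrix (Fin m) (Fin m) ℝ)
    (S : Matrix (Fin n) (Fin n) ℂ) (X : Matrix (Fin m) (Fin n) ℂ) :
    kron M S *ᵥ flatten X = flatten (mc M * X * Sᵀ) := by
  ext k
  rw [mulVec, dotProduct, ← finProdFinEquiv.sum_comp, Fintype.sum_prod_type]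
  simp only [kron, flatten, submatrix_apply, kroneckerMap_apply, Equiv.symm_apply_apply, mul_apply,
    transpose_apply, Finset.sum_mul]
  rw [Finset.sum_comm]
  exact Finset.sum_congr rfl fun i _ => Finset.sum_congr rfl fun j _ => by ring

theorem InS.kron {m n : ℕ} {M : Matrix (Fin m) (Fin m) ℝ} (hM : M.IsSymm) (hMpos : M.PosDef)
    {S : Matrix (Fin n) (Fin n) ℂ} (hS : InS S) : InS (kron M S) := by
  constructor
  · ext i j
    simp [_root_.kron, mc, hM.apply, hS.1.apply]
  · have h : (_root_.kron M S).map Complex.re =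
        (M ⊗ₖ S.map Complex.re).submatrix finProdFinEquiv.symm finProdFinEquiv.symm := by
      ext i j
      simp [_root_.kron, mc]
    rw [h]
    exact (hMpos.kronecker hS.2).submatrix finProdFinEquiv.symm.injective

theorem mc_one {k : ℕ} : mc (1 : Matrix (Fin k) (Fin k) ℝ) = 1 :=
  Matrix.map_one _ Complex.ofReal_zero Complex.ofReal_one

theorem inS_one {k : ℕ} : InS (1 : Matrix (Fin k) (Fin k) ℂ) := by
  refine ⟨isSymm_one, ?_⟩
  rw [Matrix.map_one _ Complex.zero_re Complex.one_re]
  exact PosDef.one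

theorem det_mc {k : ℕ} (M : Matrix (Fin k) (Fin k) ℝ) : (mc M).det = (M.det : ℂ) :=
  (Complex.ofRealHom.map_det M).symm

theorem det_kron {m n : ℕ} {M : Matrix (Fin m) (Fin m) ℝ} (hM : M.det = 1)
    (S : Matrix (Fin n) (Fin n) ℂ) : (kron M S).det = S.det ^ m := by
  rw [kron, det_submatrix_equiv_self, det_kronecker, det_mc, hM]
  simp

theorem convex_inS {n : ℕ} : Convex ℝ {S : Matrix (Fin n) (Fin n) ℂ | InS S} := by
  refine convex_iff_forall_pos.mpr fun S hS T hT a b ha hb _ => ⟨?_, ?_⟩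
  · ext i j
    simp [hS.1.apply i j, hT.1.apply i j]
  · have h : (a • S + b • T).map Complex.re = a • S.map Complex.re + b • T.map Complex.re := by
      ext i j; simp
    rw [h]
    exact (hS.2.smul ha).add (hT.2.smul hb)

theorem sqrtDet_kron {m n : ℕ} {sqD : Matrix (Fin n) (Fin n) ℂ → ℂ}
    (hcont : ContinuousOn sqD {S | InS S})
    (hsq : ∀ S, InS S → sqD S ^ 2 = S.det)
    (hposval : ∀ S : Matrix (Fin n) (Fin n) ℝ, S.PosDef → sqD (mc S) = Real.sqrt S.det)
    {M : Matrix (Fin m) (Fin m) ℝ} (hM : M.IsSymm) (hMpos : M.PosDef) (hMdet : M.det = 1)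
    {S : Matrix (Fin n) (Fin n) ℂ} (hS : InS S) : sqrtDet (kron M S) = sqD S ^ m := by
  refine convex_inS.isPreconnected.eq_of_sq_eq (f := fun S => sqrtDet (kron M S))
    (g := fun S => sqD S ^ m) ?_ (hcont.pow m) (fun T hT => ?_) (fun {T} hT => ?_) inS_one ?_ hS
  · refine continuousOn_sqrtDet.comp (Continuous.continuousOn ?_)
      fun T hT => InS.kron hM hMpos hT
    refine continuous_pi fun i => continuous_pi fun j => ?_
    exact continuous_const.mul (continuous_id.matrix_elem _ _)
  · simp only [Pi.pow_apply]
    rw [sqrtDet_sq (InS.kron hM hMpos hT), det_kron hMdet, ← hsq T hT, pow_right_comm]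
  · refine pow_ne_zero m fun h => hT.isUnit_det.ne_zero ?_
    rw [← hsq T hT, h, zero_pow two_ne_zero]
  · have hreal : kron M (1 : Matrix (Fin n) (Fin n) ℂ) =
        mc ((M ⊗ₖ (1 : Matrix (Fin n) (Fin n) ℝ)).submatrix
          finProdFinEquiv.symm finProdFinEquiv.symm) := by
      rw [← mc_one]
      ext i j
      simp only [kron, mc, submatrix_apply, kroneckerMap_apply, map_apply, Complex.ofReal_mul]
    have hin := InS.kron hM hMpos (inS_one (k := n))
    obtain ⟨r, hr, hr'⟩ := exists_sqrtDet_mc _ (hreal ▸ hin)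
    have hr2 := sqrtDet_sq hin
    rw [det_kron hMdet, hreal, hr', det_one, one_pow] at hr2
    have hr1 : r = 1 :=
      (pow_eq_one_iff_of_nonneg hr.le two_ne_zero).mp (by exact_mod_cast hr2)
    change sqrtDet (kron M 1) = sqD 1 ^ m
    rw [hreal, hr', hr1, ← mc_one, hposval 1 PosDef.one]
    simp

/-- Left multiplication by a unimodular integer matrix. -/
def unimodularEquiv {m n : ℕ} (U : Matrix (Fin m) (Fin m) ℤ) (hU : IsUnit U.det) :
    (Fin m → Fin n → ℤ) ≃ (Fin m → Fin n → ℤ) where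
  toFun ξ := U * (Matrix.of ξ)
  invFun ξ := U⁻¹ * (Matrix.of ξ)
  left_inv ξ := nonsing_inv_mul_cancel_left U (Matrix.of ξ) hU
  right_inv ξ := mul_nonsing_inv_cancel_left U (Matrix.of ξ) hU

/-- Integer arrays listed as integer vectors. -/
def flattenInt (m n : ℕ) : (Fin m → Fin n → ℤ) ≃ (Fin (m * n) → ℤ) :=
  (Equiv.curry (Fin m) (Fin n) ℤ).symm.trans (finProdFinEquiv.arrowCongr (Equiv.refl ℤ))

theorem intVec_flattenInt {m n : ℕ} (ξ : Fin m → Fin n → ℤ) :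
    intVec (flattenInt m n ξ) = flatten (zc ξ) := rfl

theorem mc_isSymm {k : ℕ} {M : Matrix (Fin k) (Fin k) ℝ} (hM : M.IsSymm) : (mc M).IsSymm :=
  hM.map _

theorem InSiegel.inS {n : ℕ} {Ω : Matrix (Fin n) (Fin n) ℂ} (hΩ : InSiegel Ω) :
    InS (-Complex.I • Ω) := by
  refine ⟨hΩ.1.smul _, ?_⟩
  have : (-Complex.I • Ω).map Complex.re = Ω.map Complex.im := by
    ext i j; simp
  rw [this]
  exact hΩ.2

theorem InSiegel.isUnit_det {n : ℕ} {Ω : Matrix (Fin n) (Fin n) ℂ} (hΩ : InSiegel Ω) :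
    IsUnit Ω.det := by
  have h := hΩ.inS.isUnit_det
  rw [det_smul] at h
  exact isUnit_of_mul_isUnit_right h

theorem thetaKernel_eq_gaussTerm {m n : ℕ} {M : Matrix (Fin m) (Fin m) ℝ} (hM : M.IsSymm)
    (Ω : Matrix (Fin n) (Fin n) ℂ) (Z X : Matrix (Fin m) (Fin n) ℂ) :
    thetaKernel M Ω Z X =
      gaussTerm (kron M (-Complex.I • Ω)) (flatten (mc M * Z)) (flatten X) := by
  have h₁ : (X * (mc M * X * (-Complex.I • Ω)ᵀ)ᵀ).trace =
      -Complex.I * (mc M * (X * Ω * Xᵀ)).trace := by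
    rw [transpose_mul, transpose_mul, transpose_transpose, mc_isSymm hM, Matrix.smul_mul,
      Matrix.mul_smul, trace_smul, smul_eq_mul, ← Matrix.mul_assoc, ← Matrix.mul_assoc,
      trace_mul_comm]
  have h₂ : (X * (mc M * Z)ᵀ).trace = (mc M * (X * Zᵀ)).trace := by
    rw [transpose_mul, mc_isSymm hM, ← Matrix.mul_assoc, trace_mul_comm]
  rw [thetaKernel, gaussTerm, kron_mulVec_flatten, flatten_dotProduct_flatten,
    flatten_dotProduct_flatten, h₁, h₂, Matrix.mul_add, Matrix.mul_smul, trace_add, trace_smul,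
    smul_eq_mul]
  congr 1
  ring

theorem gauss_shift_kron_inv {m n : ℕ} {M : Matrix (Fin m) (Fin m) ℝ} (hM : M.IsSymm)
    (hMpos : M.PosDef) {Ω : Matrix (Fin n) (Fin n) ℂ} (hΩ : InSiegel Ω)
    (Z X : Matrix (Fin m) (Fin n) ℂ) :
    Complex.exp (-Real.pi * ((flatten (mc M * X) - flatten (mc M * Z)) ⬝ᵥ
        (kron M (-Complex.I • Ω))⁻¹ *ᵥ (flatten (mc M * X) - flatten (mc M * Z)))) =
      Complex.exp (-(Real.pi * Complex.I * (mc M * (Z * Ω⁻¹ * Zᵀ)).trace)) *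
        thetaKernel M (-Ω⁻¹) (Z * Ω⁻¹) X := by
  have hM' := mc_isSymm hM
  have hΩinv : Ω⁻¹.IsSymm := hΩ.1.inv
  have hinv : (kron M (-Complex.I • Ω))⁻¹ *ᵥ flatten (mc M * (X - Z)) =
      flatten (Complex.I • ((X - Z) * Ω⁻¹)) := by
    have h : kron M (-Complex.I • Ω) *ᵥ flatten (Complex.I • ((X - Z) * Ω⁻¹)) =
        flatten (mc M * (X - Z)) := by
      rw [kron_mulVec_flatten, transpose_smul, hΩ.1, Matrix.mul_smul, Matrix.mul_smul,
        Matrix.smul_mul, smul_smul, Matrix.mul_assoc, Matrix.mul_assoc,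
        nonsing_inv_mul _ hΩ.isUnit_det, Matrix.mul_one]
      simp
    rw [← h, mulVec_mulVec, nonsing_inv_mul _ (InS.kron hM hMpos hΩ.inS).isUnit_det, one_mulVec]
  have hcross : (mc M * (Z * Ω⁻¹ * Xᵀ)).trace = (mc M * (X * Ω⁻¹ * Zᵀ)).trace := by
    rw [← trace_transpose]
    simp only [transpose_mul, transpose_transpose, hM'.eq, hΩinv.eq]
    rw [trace_mul_comm, Matrix.mul_assoc]
  have hquad : flatten (mc M * (X - Z)) ⬝ᵥ flatten (Complex.I • ((X - Z) * Ω⁻¹)) =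
      Complex.I * ((mc M * (X * Ω⁻¹ * Xᵀ)).trace - 2 * (mc M * (X * Ω⁻¹ * Zᵀ)).trace +
        (mc M * (Z * Ω⁻¹ * Zᵀ)).trace) := by
    rw [flatten_dotProduct_flatten, transpose_smul, transpose_mul, hΩinv, Matrix.mul_smul,
      trace_smul, smul_eq_mul, Matrix.mul_assoc, ← Matrix.mul_assoc (X - Z)]
    simp only [transpose_sub, Matrix.sub_mul, Matrix.mul_sub, trace_sub, hcross]
    ring
  rw [← flatten_sub, ← Matrix.mul_sub, hinv, hquad, thetaKernel, ← Complex.exp_add,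
    transpose_mul, hΩinv, ← Matrix.mul_assoc X, Matrix.mul_add, Matrix.mul_smul, trace_add,
    trace_smul, smul_eq_mul, Matrix.mul_neg, Matrix.neg_mul, Matrix.mul_neg, trace_neg]
  congr 1
  ring

theorem sqrtDet_kron_mul_Theta {m n : ℕ} {M : Matrix (Fin m) (Fin m) ℝ} (hM : M.IsSymm)
    (hMpos : M.PosDef) (hMint : ∀ i j, ∃ k : ℤ, M i j = k) (hMdet : M.det = 1)
    {Ω : Matrix (Fin n) (Fin n) ℂ} (hΩ : InSiegel Ω) (Z : Matrix (Fin m) (Fin n) ℂ) :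
    sqrtDet (kron M (-Complex.I • Ω)) * Theta M Ω Z =
      Complex.exp (-(Real.pi * Complex.I * (mc M * (Z * Ω⁻¹ * Zᵀ)).trace)) *
        Theta M (-Ω⁻¹) (Z * Ω⁻¹) := by
  choose U hU using hMint
  have hUM : (Matrix.of U).map (Int.castRingHom ℝ) = M := by
    ext i j; simp [hU]
  have hUdet : (Matrix.of U).det = 1 := by
    have h := (Int.castRingHom ℝ).map_det (Matrix.of U)
    rw [RingHom.mapMatrix_apply, hUM, hMdet, eq_intCast] at h
    exact_mod_cast h
  have hUunit : IsUnit (Matrix.of U).det := hUdet ▸ isUnit_one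
  have hzc : ∀ ξ : Fin m → Fin n → ℤ,
      zc (unimodularEquiv (Matrix.of U) hUunit ξ) = mc M * zc ξ := fun ξ => by
    ext i j
    change (((Matrix.of U * Matrix.of ξ) i j : ℤ) : ℂ) = _
    simp [zc, mc, mul_apply, hU]
  have hleft : Theta M Ω Z = ∑' ξ : Fin (m * n) → ℤ,
      gaussTerm (kron M (-Complex.I • Ω)) (flatten (mc M * Z)) (intVec ξ) := by
    rw [Theta, ← (flattenInt m n).tsum_eq]
    simp only [intVec_flattenInt, thetaKernel_eq_gaussTerm hM]
  rw [hleft, sqrtDet_mul_tsum_gaussTerm (InS.kron hM hMpos hΩ.inS), Theta, ← tsum_mul_left,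
    ← ((unimodularEquiv (Matrix.of U) hUunit).trans (flattenInt m n)).tsum_eq]
  refine tsum_congr fun ξ => ?_
  rw [Equiv.trans_apply, intVec_flattenInt, hzc, gauss_shift_kron_inv hM hMpos hΩ]

theorem neg_I_cpow_mul_I_cpow_pow (m n : ℕ) :
    (-Complex.I) ^ (((m * n : ℕ) : ℂ) / 2) * (Complex.I ^ ((n : ℂ) / 2)) ^ m = 1 := by
  rw [Complex.cpow_def_of_ne_zero (neg_ne_zero.mpr Complex.I_ne_zero),
    Complex.cpow_def_of_ne_zero Complex.I_ne_zero, Complex.log_neg_I, Complex.log_I,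
    ← Complex.exp_nat_mul, ← Complex.exp_add]
  convert Complex.exp_zero using 2
  push_cast
  ring

/-- Theta inversion formula: for `M` symmetric positive definite integral with
`det M = 1`,
`Θ_M(−Ω⁻¹, ZΩ⁻¹) = (−i)^{mn/2}·(det Ω)^{m/2}·exp(πi·tr(MZΩ⁻¹ᵗZ))·Θ_M(Ω,Z)`,
where `(det Ω)^{1/2} = i^{n/2}·sqD(Ω/i)` with `sqD` the holomorphic branch of
`det^{1/2}` on matrices with positive definite real part which is positive on real
positive definite matrices (so that the value at `Ω = iIₙ` is the positive one). -/
theorem theta_inversion {n m : ℕ}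
    (sqD : Matrix (Fin n) (Fin n) ℂ → ℂ)
    (hcont : ContinuousOn sqD {S | InS S})
    (hsq : ∀ S, InS S → (sqD S) ^ 2 = S.det)
    (hposval : ∀ S : Matrix (Fin n) (Fin n) ℝ, S.PosDef → sqD (mc S) = Real.sqrt S.det)
    (M : Matrix (Fin m) (Fin m) ℝ) (hM : M.IsSymm) (hMpos : M.PosDef)
    (hMint : ∀ i j, ∃ k : ℤ, M i j = k) (hMdet : M.det = 1)
    (Ω : Matrix (Fin n) (Fin n) ℂ) (hΩ : InSiegel Ω) (Z : Matrix (Fin m) (Fin n) ℂ) :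
    Theta M (-Ω⁻¹) (Z * Ω⁻¹)
      = ((-Complex.I) ^ (((m * n : ℕ) : ℂ) / 2)) *
        ((Complex.I ^ ((n : ℂ) / 2) * sqD ((-Complex.I) • Ω)) ^ (m : ℕ)) *
        Complex.exp ((Real.pi : ℂ) * Complex.I * (mc M * (Z * Ω⁻¹ * Zᵀ)).trace) *
        Theta M Ω Z := by
  have h := sqrtDet_kron_mul_Theta hM hMpos hMint hMdet hΩ Z
  rw [sqrtDet_kron hcont hsq hposval hM hMpos hMdet hΩ.inS, Complex.exp_neg] at h
  rw [mul_pow, ← mul_assoc, neg_I_cpow_mul_I_cpow_pow, one_mul, mul_right_comm, h, mul_right_comm,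
    inv_mul_cancel₀ (Complex.exp_ne_zero _), one_mul]
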